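/- For every n ≥ 1, the Minkowski sum, over all pairs (I,J) of nonempty consecutive intervals of [n], of the polytopes conv({0} ∪ {e_i − e_j : i ∈ I, j ∈ J}) and conv({0} ∪ {e_j − e_i : i ∈ I, j ∈ J}) (which are translates of the shard polytopes SP(yin(I,J)) and SP(yang(I,J)) of the yin and yang arcs), equals the set of x ∈ ℝ^n with Σ_{i∈[n]} x_i = 0 and, for every nonempty proper subset X ⊊ [n], Σ_{i∈X} x_i ≤ #{(I,J) : I ⊄ X and J ⊄ [n]∖X} + #{(I,J) : I ⊄ [n]∖X and J ⊄ X}, where (I,J) ranges over all pairs of nonempty consecutive intervals of [n]. This polytope realizes the strong rectangulotope SRP(n). -/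

import Mathlib

open Classical Pointwise

noncomputable section

/-- An interval of `[n]`: a nonempty set of consecutive integers. -/
def IsInterval {n : ℕ} (I : Finset (Fin n)) : Prop :=
  I.Nonempty ∧ ∀ a b c : Fin n, a ∈ I → c ∈ I → a ≤ b → b ≤ c → b ∈ I

/-- Two intervals `I`, `J` of `[n]` are consecutive if `max I = min J − 1`. -/
def ConsecIntervals {n : ℕ} (I J : Finset (Fin n)) : Prop :=
  ∃ (hI : IsInterval I) (hJ : IsInterval J),
    (I.max' hI.1 : ℕ) + 1 = (J.min' hJ.1 : ℕ)

/-- The standard basis vector `e i` of `ℝ^n`. -/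
def stdVec (n : ℕ) (i : Fin n) : Fin n → ℝ := fun k => if k = i then 1 else 0

/-- `f_≍(X)`: number of intervals of `[n]` contained neither in `X` nor in its complement. -/
def fWeak (n : ℕ) (X : Finset (Fin n)) : ℕ :=
  {I : Finset (Fin n) | IsInterval I ∧ ¬ I ⊆ X ∧ ¬ I ⊆ Xᶜ}.ncard

/-- `f_⥮(X)`. -/
def fStrong (n : ℕ) (X : Finset (Fin n)) : ℕ :=
  {p : Finset (Fin n) × Finset (Fin n) |
      ConsecIntervals p.1 p.2 ∧ ¬ p.1 ⊆ X ∧ ¬ p.2 ⊆ Xᶜ}.ncard +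
  {p : Finset (Fin n) × Finset (Fin n) |
      ConsecIntervals p.1 p.2 ∧ ¬ p.1 ⊆ Xᶜ ∧ ¬ p.2 ⊆ X}.ncard


def DD {n : ℕ} (I J : Finset (Fin n)) : Set (Fin n → ℝ) :=
  insert 0 {x : Fin n → ℝ | ∃ i ∈ I, ∃ j ∈ J, x = stdVec n i - stdVec n j}

def gg {n : ℕ} (I J X : Finset (Fin n)) : ℝ := if ¬ I ⊆ Xᶜ ∧ ¬ J ⊆ X then 1 else 0

lemma DD_swap {n : ℕ} (I J : Finset (Fin n)) :
    (insert 0 {x : Fin n → ℝ | ∃ i ∈ I, ∃ j ∈ J, x = stdVec n j - stdVec n i}) = DD J I := by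
  unfold DD
  congr 1
  ext x
  constructor
  · rintro ⟨i, hi, j, hj, h⟩; exact ⟨j, hj, i, hi, h⟩
  · rintro ⟨i, hi, j, hj, h⟩; exact ⟨j, hj, i, hi, h⟩

lemma DD_def {n : ℕ} (I J : Finset (Fin n)) :
    (insert 0 {x : Fin n → ℝ | ∃ i ∈ I, ∃ j ∈ J, x = stdVec n i - stdVec n j}) = DD I J := rfl

lemma DD_finite {n : ℕ} (I J : Finset (Fin n)) : (DD I J).Finite := by
  unfold DD
  apply Set.Finite.insert
  apply Set.Finite.subset
    ((Set.finite_univ (α := Fin n × Fin n)).image (fun p => stdVec n p.1 - stdVec n p.2))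
  rintro x ⟨i, -, j, -, rfl⟩
  exact ⟨(i, j), trivial, rfl⟩

lemma sum_stdVec {n : ℕ} (X : Finset (Fin n)) (i : Fin n) :
    ∑ k ∈ X, stdVec n i k = if i ∈ X then 1 else 0 := by
  simp [stdVec]

lemma DD_le {n : ℕ} (I J X : Finset (Fin n)) (x : Fin n → ℝ) (hx : x ∈ DD I J) :
    ∑ k ∈ X, x k ≤ gg I J X := by
  rcases hx with rfl | ⟨i, hi, j, hj, rfl⟩
  · unfold gg; simp only [Pi.zero_apply, Finset.sum_const_zero]; split_ifs <;> norm_num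
  · simp only [Pi.sub_apply, Finset.sum_sub_distrib, sum_stdVec]
    by_cases h1 : i ∈ X
    · by_cases h2 : j ∈ X
      · simp only [h1, h2, if_true]; unfold gg; split_ifs <;> norm_num
      · have : ¬ I ⊆ Xᶜ ∧ ¬ J ⊆ X :=
          ⟨fun h => by simpa [h1] using h hi, fun h => h2 (h hj)⟩
        simp [gg, this, h1, h2]
    · simp only [h1, if_false]; unfold gg; split_ifs <;> norm_num

lemma DD_sum_zero {n : ℕ} (I J : Finset (Fin n)) (x : Fin n → ℝ) (hx : x ∈ DD I J) :
    ∑ k, x k = 0 := by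
  rcases hx with rfl | ⟨i, hi, j, hj, rfl⟩
  · simp
  · simp only [Pi.sub_apply, Finset.sum_sub_distrib, sum_stdVec]; simp

lemma hull_le {n : ℕ} (I J X : Finset (Fin n)) (x : Fin n → ℝ)
    (hx : x ∈ convexHull ℝ (DD I J)) : ∑ k ∈ X, x k ≤ gg I J X := by
  have hc : Convex ℝ {x : Fin n → ℝ | ∑ k ∈ X, x k ≤ gg I J X} := by
    apply convex_halfSpace_le
    constructor
    · intro x y; simp [Finset.sum_add_distrib]
    · intro c x; simp [Finset.mul_sum]
  exact convexHull_min (fun y hy => DD_le I J X y hy) hc hx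

lemma hull_sum_zero {n : ℕ} (I J : Finset (Fin n)) (x : Fin n → ℝ)
    (hx : x ∈ convexHull ℝ (DD I J)) : ∑ k, x k = 0 := by
  have hc : Convex ℝ {x : Fin n → ℝ | ∑ k, x k = 0} := by
    apply convex_hyperplane
    constructor
    · intro x y; simp [Finset.sum_add_distrib]
    · intro c x; simp [Finset.mul_sum]
  exact convexHull_min (fun y hy => DD_sum_zero I J y hy) hc hx

lemma exists_opt {n : ℕ} (I J : Finset (Fin n)) (hI : I.Nonempty) (hJ : J.Nonempty)
    (w : Fin n → ℝ) :
    ∃ v ∈ DD I J, ∀ t : ℝ, ∑ k ∈ Finset.univ.filter (fun k => t ≤ w k), v k =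
      gg I J (Finset.univ.filter (fun k => t ≤ w k)) := by
  obtain ⟨i, hi, him⟩ := I.exists_max_image w hI
  obtain ⟨j, hj, hjm⟩ := J.exists_min_image w hJ
  have key : ∀ t : ℝ, gg I J (Finset.univ.filter (fun k => t ≤ w k)) =
      if t ≤ w i ∧ w j < t then 1 else 0 := by
    intro t
    unfold gg
    congr 1
    apply propext
    apply and_congr
    · rw [Finset.not_subset]
      constructor
      · rintro ⟨a, ha, h⟩
        have h' : t ≤ w a := by simpa using h
        exact h'.trans (him a ha)
      · intro h; exact ⟨i, hi, by simpa using h⟩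
    · rw [Finset.not_subset]
      constructor
      · rintro ⟨a, ha, h⟩
        have h' : w a < t := by simpa using h
        exact (hjm a ha).trans_lt h'
      · intro h; exact ⟨j, hj, by simpa using h⟩
  by_cases hij : w j < w i
  · refine ⟨stdVec n i - stdVec n j, Or.inr ⟨i, hi, j, hj, rfl⟩, fun t => ?_⟩
    rw [key]
    simp only [Pi.sub_apply, Finset.sum_sub_distrib, sum_stdVec, Finset.mem_filter,
      Finset.mem_univ, true_and]
    by_cases h1 : t ≤ w i
    · by_cases h2 : t ≤ w j
      · simp [h1, h2, not_lt.mpr h2]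
      · simp [h1, h2, not_le.mp h2]
    · have h2 : ¬ t ≤ w j := fun h => h1 (h.trans hij.le)
      simp [h1, h2]
  · refine ⟨0, Or.inl rfl, fun t => ?_⟩
    rw [key, if_neg]
    · simp
    · rintro ⟨h1, h2⟩; exact hij (h2.trans_le h1)

lemma layer {n : ℕ} (y : Fin n → ℝ) : ∀ (m : ℕ) (w : Fin n → ℝ), (∀ i, 0 ≤ w i) →
    (Finset.univ.filter (fun k => 0 < w k)).card = m →
    (∀ t : ℝ, 0 < t → 0 ≤ ∑ k ∈ Finset.univ.filter (fun k => t ≤ w k), y k) →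
    0 ≤ ∑ k, w k * y k := by
  intro m
  induction m using Nat.strong_induction_on with
  | _ m ih =>
    intro w hw hm h
    by_cases hne : (Finset.univ.filter (fun k => 0 < w k)).Nonempty
    · obtain ⟨a, ha, hmin⟩ := Finset.exists_min_image _ w hne
      have ha0 : 0 < w a := by simpa using ha
      have hmin' : ∀ k, 0 < w k → w a ≤ w k := fun k hk => hmin k (by simpa using hk)
      have e : ∀ k, w k = (if w a ≤ w k then w a else 0) +
          (if w a ≤ w k then w k - w a else 0) := by
        intro k
        split_ifs with hk
        · ring
        · have : ¬ 0 < w k := fun h0 => hk (hmin' k h0)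
          linarith [hw k]
      have h2 := ih _ ?_ (fun k => if w a ≤ w k then w k - w a else 0) ?_ rfl ?_
      · have h3 : ∑ k, w k * y k = w a * (∑ k ∈ Finset.univ.filter (fun k => w a ≤ w k), y k) +
            ∑ k, (if w a ≤ w k then w k - w a else 0) * y k := by
          rw [Finset.sum_filter, Finset.mul_sum, ← Finset.sum_add_distrib]
          apply Finset.sum_congr rfl
          intro k _
          have h4 := e k
          split_ifs at h4 ⊢ with hk
          · ring
          · rw [h4]; ring
        rw [h3]
        exact add_nonneg (mul_nonneg ha0.le (h _ ha0)) h2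
      · rw [← hm]
        apply Finset.card_lt_card
        rw [Finset.ssubset_iff_of_subset]
        · exact ⟨a, ha, by simp⟩
        · intro k hk
          simp only [Finset.mem_filter, Finset.mem_univ, true_and] at hk ⊢
          split_ifs at hk with h0
          · linarith
          · exact absurd hk (lt_irrefl _)
      · intro k
        split_ifs with h0
        · linarith
        · exact le_rfl
      · intro t ht
        have := h (t + w a) (by linarith)
        convert this using 3
        rename_i k
        split_ifs with h0
        · constructor <;> intro <;> linarith
        · constructor <;> intro <;> linarith
    · have : ∀ k, w k = 0 := by
        intro k
        by_contra hk
        exact hne ⟨k, by simpa using lt_of_le_of_ne (hw k) (Ne.symm hk)⟩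
      simp [this]

lemma layer' {n : ℕ} (y w : Fin n → ℝ) (h0 : ∑ k, y k = 0)
    (h : ∀ t : ℝ, 0 ≤ ∑ k ∈ Finset.univ.filter (fun k => t ≤ w k), y k) :
    0 ≤ ∑ k, w k * y k := by
  obtain ⟨c, hc⟩ : ∃ c : ℝ, ∀ k, 0 ≤ w k + c := by
    refine ⟨∑ k, |w k|, fun k => ?_⟩
    have h1 := Finset.single_le_sum (f := fun k => |w k|) (fun i _ => abs_nonneg _)
      (Finset.mem_univ k)
    have h2 := neg_abs_le (w k)
    linarith
  have := layer y _ (fun k => w k + c) hc rfl (fun t _ => by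
    have := h (t - c)
    simpa only [sub_le_iff_le_add] using this)
  simpa [add_mul, Finset.sum_add_distrib, ← Finset.mul_sum, h0] using this

lemma fStrong_eq (n : ℕ) (X : Finset (Fin n)) : (fStrong n X : ℝ) =
    ∑ p ∈ Finset.univ.filter
      (fun p : Finset (Fin n) × Finset (Fin n) => ConsecIntervals p.1 p.2),
      (gg p.1 p.2 X + gg p.2 p.1 X) := by
  have aux : ∀ P : Finset (Fin n) × Finset (Fin n) → Prop,
      (({p | ConsecIntervals p.1 p.2 ∧ P p} : Set (Finset (Fin n) × Finset (Fin n))).ncard : ℝ) =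
      ∑ p ∈ Finset.univ.filter
      (fun p : Finset (Fin n) × Finset (Fin n) => ConsecIntervals p.1 p.2),
        if P p then 1 else 0 := by
    intro P
    rw [← Finset.sum_filter, Finset.filter_filter, Finset.sum_const, nsmul_eq_mul, mul_one,
      ← Set.ncard_coe_finset]
    simp
  unfold fStrong
  rw [Nat.cast_add, Finset.sum_add_distrib, add_comm, aux, aux]
  refine congrArg₂ (· + ·) ?_ ?_
  · apply Finset.sum_congr rfl
    intro p _
    unfold gg
    congr 1
  · apply Finset.sum_congr rfl
    intro p _
    unfold gg
    congr 1
    exact propext and_comm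

lemma gg_empty {n : ℕ} (I J : Finset (Fin n)) : gg I J ∅ = 0 := by simp [gg]

lemma gg_univ {n : ℕ} (I J : Finset (Fin n)) : gg I J Finset.univ = 0 := by simp [gg]

/-- the Minkowski sum, over all pairs `(I,J)` of nonempty
consecutive intervals of `[n]`, of `conv({0} ∪ {e_i − e_j : i ∈ I, j ∈ J})` and
`conv({0} ∪ {e_j − e_i : i ∈ I, j ∈ J})` (translates of the shard polytopes of
the yin and yang arcs) equals the H-description of the strong rectangulotope
`SRP(n)`. -/
theorem strong_rectangulotope_minkowski (n : ℕ) (hn : 1 ≤ n) :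
    (∑ p ∈ Finset.univ.filter
          (fun p : Finset (Fin n) × Finset (Fin n) => ConsecIntervals p.1 p.2),
        (convexHull ℝ
            (insert 0 {x : Fin n → ℝ | ∃ i ∈ p.1, ∃ j ∈ p.2, x = stdVec n i - stdVec n j}) +
          convexHull ℝ
            (insert 0 {x : Fin n → ℝ | ∃ i ∈ p.1, ∃ j ∈ p.2, x = stdVec n j - stdVec n i}))) =
      {x : Fin n → ℝ | (∑ i, x i) = 0 ∧
        ∀ X : Finset (Fin n), X.Nonempty → X ≠ Finset.univ →
          (∑ i ∈ X, x i) ≤ (fStrong n X : ℝ)} := by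
  simp only [DD_swap, DD_def]
  set S := Finset.univ.filter
    (fun p : Finset (Fin n) × Finset (Fin n) => ConsecIntervals p.1 p.2) with hS
  apply Set.Subset.antisymm
  · intro x hx
    obtain ⟨g, hg, rfl⟩ := (Set.mem_finsetSum S _ x).1 hx
    refine ⟨?_, fun X _ _ => ?_⟩
    · simp only [Finset.sum_apply]
      rw [Finset.sum_comm]
      apply Finset.sum_eq_zero
      intro p hp
      obtain ⟨u, hu, v, hv, huv⟩ := hg hp
      rw [← huv]
      simp [Finset.sum_add_distrib, hull_sum_zero _ _ u hu, hull_sum_zero _ _ v hv]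
    · rw [fStrong_eq]
      simp only [Finset.sum_apply]
      rw [Finset.sum_comm]
      apply Finset.sum_le_sum
      intro p hp
      obtain ⟨u, hu, v, hv, huv⟩ := hg hp
      rw [← huv]
      simp only [Pi.add_apply, Finset.sum_add_distrib]
      exact add_le_add (hull_le _ _ X u hu) (hull_le _ _ X v hv)
  · rintro x ⟨hx0, hx⟩
    by_contra hnot
    simp only [← convexHull_add] at hnot
    rw [← convexHull_sum] at hnot
    have hfin : (∑ p ∈ S, (DD p.1 p.2 + DD p.2 p.1)).Finite := by
      apply Finset.sum_induction _ Set.Finite (fun a b => Set.Finite.add) Set.finite_zero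
      intro p _
      exact (DD_finite _ _).add (DD_finite _ _)
    obtain ⟨f, u, hfu, hux⟩ := geometric_hahn_banach_closed_point
      (convex_convexHull ℝ _) (hfin.isClosed_convexHull ℝ) hnot
    set w : Fin n → ℝ := fun k => f (stdVec n k) with hw
    have hf : ∀ y : Fin n → ℝ, f y = ∑ k, w k * y k := by
      intro y
      have hy : y = ∑ k, y k • stdVec n k := by
        ext i
        simp [stdVec]
      conv_lhs => rw [hy]
      rw [map_sum]
      apply Finset.sum_congr rfl
      intro k _
      rw [map_smul, smul_eq_mul, mul_comm]
    have hne : ∀ p ∈ S, p.1.Nonempty ∧ p.2.Nonempty := by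
      intro p hp
      obtain ⟨h1, h2, -⟩ := (Finset.mem_filter.1 hp).2
      exact ⟨h1.1, h2.1⟩
    have hex : ∀ p ∈ S, ∃ v ∈ DD p.1 p.2 + DD p.2 p.1, (∑ k, v k = 0) ∧
        ∀ t : ℝ, ∑ k ∈ Finset.univ.filter (fun k => t ≤ w k), v k =
          gg p.1 p.2 (Finset.univ.filter (fun k => t ≤ w k)) +
          gg p.2 p.1 (Finset.univ.filter (fun k => t ≤ w k)) := by
      intro p hp
      obtain ⟨h1, h2⟩ := hne p hp
      obtain ⟨a, ha, hat⟩ := exists_opt p.1 p.2 h1 h2 w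
      obtain ⟨b, hb, hbt⟩ := exists_opt p.2 p.1 h2 h1 w
      refine ⟨a + b, Set.add_mem_add ha hb, ?_, fun t => ?_⟩
      · simp [Finset.sum_add_distrib, DD_sum_zero _ _ a ha, DD_sum_zero _ _ b hb]
      · rw [← hat, ← hbt, ← Finset.sum_add_distrib]
        rfl
    choose! v hv hv0 hvt using hex
    have hV : (∑ p ∈ S, v p) ∈ ∑ p ∈ S, (DD p.1 p.2 + DD p.2 p.1) :=
      Set.finsetSum_mem_finsetSum S _ v hv
    have h1 := hfu _ (subset_convexHull ℝ _ hV)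
    have h2 := layer' (fun k => (∑ p ∈ S, v p) k - x k) w ?_ ?_
    · simp only [mul_sub, Finset.sum_sub_distrib] at h2
      rw [← hf, ← hf] at h2
      linarith
    · rw [Finset.sum_sub_distrib, hx0, sub_zero]
      simp only [Finset.sum_apply]
      rw [Finset.sum_comm]
      exact Finset.sum_eq_zero hv0
    · intro t
      rw [Finset.sum_sub_distrib, sub_nonneg]
      have h3 : ∑ k ∈ Finset.univ.filter (fun k => t ≤ w k), (∑ p ∈ S, v p) k =
          (fStrong n (Finset.univ.filter (fun k => t ≤ w k)) : ℝ) := by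
        rw [fStrong_eq]
        simp only [Finset.sum_apply]
        rw [Finset.sum_comm]
        exact Finset.sum_congr rfl (fun p hp => hvt p hp t)
      rw [h3]
      generalize Finset.univ.filter (fun k => t ≤ w k) = X
      by_cases hX : X.Nonempty
      · by_cases hX' : X = Finset.univ
        · rw [hX', hx0]; positivity
        · exact hx X hX hX'
      · rw [Finset.not_nonempty_iff_eq_empty.1 hX, Finset.sum_empty]; positivity

end
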